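/- Let k be a field of characteristic zero and (R, Δ) a commutative differential k-algebra with R noetherian and dim_k R, |Δ| < |k|. Suppose Δ-spec R = ⋃_i X_i is a union of locally closed subsets such that each X_i, with the subspace topology, is homeomorphic to Spec R_i for some commutative noetherian k-algebra R_i with dim_k R_i < |k|. Then R satisfies the Δ-Dixmier-Moeglin equivalence. -/

import Mathlib

universe u

section DifferentialAlgebra

variable (k R : Type u) [Field k] [CommRing R] [Algebra k R]

/-- `I` is a `Δ`-ideal: it is stable under every derivation in `Δ`. -/
def IsDeltaIdeal (Δ : Set (Derivation k R R)) (I : Ideal R) : Prop :=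
  ∀ δ ∈ Δ, ∀ x ∈ I, δ x ∈ I

/-- `P` is a `Δ`-prime ideal: a prime ideal which is a `Δ`-ideal. -/
def IsDeltaPrime (Δ : Set (Derivation k R R)) (P : Ideal R) : Prop :=
  P.IsPrime ∧ IsDeltaIdeal k R Δ P

/-- The `Δ`-core of an ideal `J`: the largest `Δ`-ideal contained in `J`. -/
def deltaCore (Δ : Set (Derivation k R R)) (J : Ideal R) : Ideal R :=
  sSup {I : Ideal R | IsDeltaIdeal k R Δ I ∧ I ≤ J}

/-- `P` is `Δ`-primitive: it is the `Δ`-core of some maximal ideal. -/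
def IsDeltaPrimitive (Δ : Set (Derivation k R R)) (P : Ideal R) : Prop :=
  ∃ M : Ideal R, M.IsMaximal ∧ deltaCore k R Δ M = P

/-- `Δ`-spec `R`: the set of `Δ`-prime ideals, topologized as a subspace of `Spec R`. -/
abbrev DeltaSpec (Δ : Set (Derivation k R R)) : Type u :=
  {P : PrimeSpectrum R // IsDeltaIdeal k R Δ P.asIdeal}

/-- `P` is `Δ`-rational: whenever `a, b ∈ R` with `b ∉ P` are such that the class of `a/b` in
`Frac(R/P)` is killed by all the induced derivations, that class is algebraic over `k`. -/
def IsDeltaRational (Δ : Set (Derivation k R R)) (P : Ideal R) (hP : P.IsPrime) : Prop :=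
  haveI := hP
  ∀ a b : R, b ∉ P → (∀ δ ∈ Δ, δ a * b - a * δ b ∈ P) →
    IsAlgebraic k
      (algebraMap (R ⧸ P) (FractionRing (R ⧸ P)) (Ideal.Quotient.mk P a) /
       algebraMap (R ⧸ P) (FractionRing (R ⧸ P)) (Ideal.Quotient.mk P b))

/-- `P` is `κ`-separable in `Δ`-spec `R`: there is a set `Λ`, of cardinality `< κ`, of `Δ`-prime
ideals properly containing `P`, such that every `Δ`-prime ideal properly containing `P` contains
a member of `Λ`. -/
def DeltaSeparable (Δ : Set (Derivation k R R)) (κ : Cardinal.{u}) (P : Ideal R) : Prop :=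
  ∃ Λ : Set (Ideal R), (∀ Q ∈ Λ, IsDeltaPrime k R Δ Q ∧ P < Q) ∧
    Cardinal.mk Λ < κ ∧
    ∀ Q : Ideal R, IsDeltaPrime k R Δ Q → P < Q → ∃ Q' ∈ Λ, Q' ≤ Q

/-- `R` satisfies the `Δ`-Dixmier–Moeglin equivalence: for every `Δ`-prime ideal `P`, the
conditions "`{P}` is locally closed in `Δ`-spec `R`", "`P` is `Δ`-primitive", and
"`P` is `Δ`-rational" are equivalent. -/
def DeltaDME (Δ : Set (Derivation k R R)) : Prop :=
  ∀ (P : PrimeSpectrum R) (hP : IsDeltaIdeal k R Δ P.asIdeal),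
    (IsLocallyClosed ({⟨P, hP⟩} : Set (DeltaSpec k R Δ)) ↔ IsDeltaPrimitive k R Δ P.asIdeal) ∧
    (IsDeltaPrimitive k R Δ P.asIdeal ↔ IsDeltaRational k R Δ P.asIdeal P.isPrime)

end DifferentialAlgebra

section TranscendenceAndRank

variable {k A : Type u} [Field k] [CommRing A] [IsDomain A] [Algebra k A]

/-- If `t` is transcendental over `k`, then at most `dim_k A` of its translates `t - a`, `a ∈ k`,
are units. -/
theorem Transcendental.mk_isUnit_sub_le_rank {t : A} (ht : Transcendental k t) :
    Cardinal.mk {a : k // IsUnit (t - algebraMap k A a)} ≤ Module.rank k A := by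
  have hinj : Function.Injective (algebraMap A (FractionRing A)) :=
    IsFractionRing.injective A (FractionRing A)
  have htK : Transcendental k (algebraMap A (FractionRing A) t) :=
    (transcendental_algebraMap_iff hinj).2 ht
  have hli := htK.linearIndependent_sub_inv.comp
    (fun a : {a : k // IsUnit (t - algebraMap k A a)} => (a : k)) Subtype.val_injective
  have hv : LinearIndependent k
      (fun a : {a : k // IsUnit (t - algebraMap k A a)} => ((a.2.unit⁻¹ : Aˣ) : A)) := by
    refine LinearIndependent.of_comp (IsScalarTower.toAlgHom k A (FractionRing A)).toLinearMap ?_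
    convert hli using 1
    funext a
    have h : algebraMap A (FractionRing A) ((a.2.unit⁻¹ : Aˣ) : A) *
        algebraMap A (FractionRing A) (t - algebraMap k A a) = 1 := by
      rw [← map_mul, IsUnit.val_inv_mul, map_one]
    have h' := eq_inv_of_mul_eq_one_left h
    simp only [Function.comp_apply, AlgHom.toLinearMap_apply, IsScalarTower.coe_toAlgHom']
    rw [h', map_sub, ← IsScalarTower.algebraMap_apply]
  exact hv.cardinal_le_rank

/-- The Nullstellensatz for fields of small dimension: such a field extension is algebraic. -/
theorem isAlgebraic_of_isField_of_rank_lt (hA : IsField A)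
    (hrank : Module.rank k A < Cardinal.mk k) : Algebra.IsAlgebraic k A := by
  refine ⟨fun t => ?_⟩
  by_contra ht
  have hunit : ∀ a : k, IsUnit (t - algebraMap k A a) := fun a =>
    let ⟨_, hy⟩ := hA.mul_inv_cancel
      fun h => ht (by rw [sub_eq_zero.1 h]; exact isAlgebraic_algebraMap a)
    IsUnit.of_mul_eq_one _ hy
  refine absurd (Transcendental.mk_isUnit_sub_le_rank ht) (not_le.2 (hrank.trans_eq ?_))
  exact (Cardinal.mk_congr (Equiv.subtypeUnivEquiv hunit)).symm

end TranscendenceAndRank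

/-- A `k`-algebra of dimension less than `|k|` is a Jacobson ring. -/
theorem exists_isMaximal_notMem_of_rank_lt {k R : Type u} [Field k] [Infinite k] [CommRing R]
    [Algebra k R] (hrank : Module.rank k R < Cardinal.mk k) (P : Ideal R) [P.IsPrime] {b : R}
    (hb : b ∉ P) : ∃ M : Ideal R, M.IsMaximal ∧ P ≤ M ∧ b ∉ M := by
  by_contra! h
  set t : R ⧸ P := Ideal.Quotient.mk P b with htdef
  have ht0 : t ≠ 0 := fun h0 => hb (Ideal.Quotient.eq_zero_iff_mem.1 h0)
  have hmem : ∀ M : Ideal (R ⧸ P), M.IsMaximal → t ∈ M := fun M hM =>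
    h (M.comap (Ideal.Quotient.mk P))
      (Ideal.comap_isMaximal_of_surjective _ Ideal.Quotient.mk_surjective)
      (by
        intro x hx
        rw [Ideal.mem_comap, Ideal.Quotient.eq_zero_iff_mem.2 hx]
        exact M.zero_mem)
  have ht : Transcendental k t := by
    intro halg
    obtain ⟨M, hM⟩ := Ideal.exists_maximal (R ⧸ P)
    exact hM.ne_top (Ideal.eq_top_of_isUnit_mem _ (hmem M hM) (halg.isIntegral.isUnit ht0))
  have hunit : ∀ a : k, a ≠ 0 → IsUnit (t - algebraMap k (R ⧸ P) a) := by
    intro a ha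
    by_contra hu
    obtain ⟨M, hM, hle⟩ := exists_max_ideal_of_mem_nonunits hu
    have hmemM : algebraMap k (R ⧸ P) a ∈ M := by
      simpa using M.sub_mem (hmem M hM) hle
    exact hM.ne_top (Ideal.eq_top_of_isUnit_mem _ hmemM ((IsUnit.mk0 a ha).map _))
  have h1 : Cardinal.mk {a : k // a ≠ 0} = Cardinal.mk k :=
    Cardinal.mk_compl_of_infinite ({0} : Set k) (by
      rw [Cardinal.mk_singleton]
      exact Cardinal.one_lt_aleph0.trans_le (Cardinal.aleph0_le_mk k))
  have h2 : Cardinal.mk {a : k // a ≠ 0} ≤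
      Cardinal.mk {a : k // IsUnit (t - algebraMap k (R ⧸ P) a)} :=
    Cardinal.mk_le_of_injective (Subtype.impEmbedding _ _ hunit).injective
  exact absurd ((h1.symm.trans_le h2).trans (Transcendental.mk_isUnit_sub_le_rank ht))
    (not_le.2 (((Ideal.Quotient.mkₐ k P).toLinearMap.rank_le_of_surjective
      (Ideal.Quotient.mkₐ_surjective k P)).trans_lt hrank))

section DeltaIdeals

variable {k R : Type u} [Field k] [CommRing R] [Algebra k R] {Δ : Set (Derivation k R R)}

theorem Derivation.mul_apply_pow (δ : Derivation k R R) (x : R) (n : ℕ) :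
    x * δ (x ^ n) = n * x ^ n * δ x := by
  rcases n with _ | n
  · simp
  · rw [Derivation.leibniz_pow]
    simp only [smul_eq_mul, nsmul_eq_mul, Nat.add_sub_cancel]
    ring

theorem IsDeltaIdeal.sSup {S : Set (Ideal R)} (hS : ∀ I ∈ S, IsDeltaIdeal k R Δ I) :
    IsDeltaIdeal k R Δ (sSup S) := by
  intro δ hδ x hx
  rw [sSup_eq_iSup'] at hx ⊢
  induction hx using Submodule.iSup_induction' with
  | mem I x hx => exact Submodule.mem_iSup_of_mem I (hS I I.2 δ hδ x hx)
  | zero => simp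
  | add x y _ _ hx hy => rw [map_add]; exact add_mem hx hy

theorem IsDeltaIdeal.sInf {S : Set (Ideal R)} (hS : ∀ I ∈ S, IsDeltaIdeal k R Δ I) :
    IsDeltaIdeal k R Δ (sInf S) := fun δ hδ x hx =>
  Submodule.mem_sInf.2 fun I hI => hS I hI δ hδ x (Submodule.mem_sInf.1 hx I hI)

theorem deltaCore_isDeltaIdeal (J : Ideal R) : IsDeltaIdeal k R Δ (deltaCore k R Δ J) :=
  IsDeltaIdeal.sSup fun _ hI => hI.1

theorem deltaCore_le (J : Ideal R) : deltaCore k R Δ J ≤ J :=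
  sSup_le fun _ hI => hI.2

theorem IsDeltaIdeal.le_deltaCore {I J : Ideal R} (hI : IsDeltaIdeal k R Δ I) (hIJ : I ≤ J) :
    I ≤ deltaCore k R Δ J :=
  le_sSup ⟨hI, hIJ⟩

/-- In characteristic zero, the minimal primes over a `Δ`-ideal are `Δ`-ideals. -/
theorem IsDeltaIdeal.of_mem_minimalPrimes [CharZero k] {I Q : Ideal R}
    (hI : IsDeltaIdeal k R Δ I) (hQ : Q ∈ I.minimalPrimes) : IsDeltaIdeal k R Δ Q := by
  intro δ hδ x hx
  have hQp : Q.IsPrime := hQ.1.1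
  obtain ⟨n, s, hs, hsx⟩ : ∃ (n : ℕ) (s : R), s ∉ Q ∧ s * x ^ n ∈ I := by
    have hx' : algebraMap R (Localization.AtPrime Q) x ∈
        (I.map (algebraMap R (Localization.AtPrime Q))).radical := by
      rw [IsLocalization.AtPrime.radical_map_of_mem_minimalPrimes _ Q I hQ]
      exact Ideal.mem_map_of_mem _ hx
    obtain ⟨n, hn⟩ := hx'
    rw [← map_pow, IsLocalization.algebraMap_mem_map_algebraMap_iff Q.primeCompl] at hn
    obtain ⟨s, hs, hsx⟩ := hn
    exact ⟨n, s, hs, hsx⟩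
  have key : ∀ (n m : ℕ) (s : R), s ∉ Q → s * x ^ n * δ x ^ m ∈ I → δ x ∈ Q := by
    intro n
    induction n with
    | zero =>
      intro m s hs h
      rw [pow_zero, mul_one] at h
      exact hQp.mem_of_pow_mem _ ((hQp.mem_or_mem (hQ.1.2 h)).resolve_left hs)
    | succ n ih =>
      intro m s hs h
      have hunit : IsUnit ((n + 1 : ℕ) : R) := by
        have : IsUnit (algebraMap k R ((n + 1 : ℕ) : k)) :=
          (IsUnit.mk0 _ (Nat.cast_ne_zero.2 n.succ_ne_zero)).map _
        simpa only [map_natCast] using this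
      refine ih (m + 2) (((n + 1 : ℕ) : R) * s ^ 2) (fun hmem => ?_) ?_
      · rcases hQp.mem_or_mem hmem with h1 | h1
        · exact hQp.ne_top (Ideal.eq_top_of_isUnit_mem _ h1 hunit)
        · exact hs (hQp.mem_of_pow_mem _ h1)
      · have hδI := I.mul_mem_left (s * δ x) (hI δ hδ _ h)
        have hI1 := I.mul_mem_left (δ s * δ x) h
        have hI2 := I.mul_mem_left (s * m * δ (δ x)) h
        have hn : δ (x ^ (n + 1)) = (n + 1 : ℕ) * x ^ n * δ x := by
          rw [Derivation.leibniz_pow]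
          simp only [smul_eq_mul, nsmul_eq_mul, Nat.add_sub_cancel]
          ring
        convert I.sub_mem (I.sub_mem hδI hI1) hI2 using 1
        simp only [Derivation.leibniz, smul_eq_mul, hn]
        linear_combination (-(s ^ 2 * x ^ (n + 1))) * δ.mul_apply_pow (δ x) m
  exact key n 0 s hs (by simpa using hsx)

theorem isPrime_deltaCore [CharZero k] (M : Ideal R) [M.IsPrime] :
    (deltaCore k R Δ M).IsPrime := by
  obtain ⟨Q, hQ, hQM⟩ := Ideal.exists_minimalPrimes_le (deltaCore_le (k := k) (Δ := Δ) M)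
  have hle := ((deltaCore_isDeltaIdeal M).of_mem_minimalPrimes hQ).le_deltaCore hQM
  rw [le_antisymm hQ.1.2 hle]
  exact hQ.1.1

end DeltaIdeals

section DixmierMoeglin

variable {k R : Type u} [Field k] [CommRing R] [Algebra k R] {Δ : Set (Derivation k R R)}

theorem exists_notMem_of_isLocallyClosed_singleton {P : DeltaSpec k R Δ}
    (hP : IsLocallyClosed ({P} : Set (DeltaSpec k R Δ))) :
    ∃ b : R, b ∉ P.1.asIdeal ∧
      ∀ Q : DeltaSpec k R Δ, P.1.asIdeal ≤ Q.1.asIdeal → b ∉ Q.1.asIdeal → Q = P := by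
  obtain ⟨U, Z, hU, hZ, hPUZ⟩ := hP
  have hPmem : P ∈ U ∩ Z := hPUZ ▸ Set.mem_singleton P
  obtain ⟨V, hV, rfl⟩ := isOpen_induced_iff.1 hU
  obtain ⟨_, ⟨b, rfl⟩, hbP, hbV⟩ :=
    PrimeSpectrum.isTopologicalBasis_basic_opens.exists_subset_of_mem_open hPmem.1 hV
  refine ⟨b, hbP, fun Q hPQ hbQ => ?_⟩
  have hspec : P ⤳ Q := by
    rw [subtype_specializes_iff, ← PrimeSpectrum.le_iff_specializes]
    exact hPQ
  have hQ : Q ∈ ({P} : Set (DeltaSpec k R Δ)) :=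
    hPUZ ▸ ⟨hbV hbQ, hspec.mem_closed hZ hPmem.2⟩
  exact hQ

theorem isDeltaPrimitive_of_isLocallyClosed [CharZero k]
    (hrank : Module.rank k R < Cardinal.mk k) {P : DeltaSpec k R Δ}
    (hP : IsLocallyClosed ({P} : Set (DeltaSpec k R Δ))) :
    IsDeltaPrimitive k R Δ P.1.asIdeal := by
  obtain ⟨b, hb, hbQ⟩ := exists_notMem_of_isLocallyClosed_singleton hP
  obtain ⟨M, hM, hPM, hbM⟩ := exists_isMaximal_notMem_of_rank_lt hrank P.1.asIdeal hb
  refine ⟨M, hM, ?_⟩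
  have h := hbQ ⟨⟨deltaCore k R Δ M, isPrime_deltaCore M⟩, deltaCore_isDeltaIdeal M⟩
    (P.2.le_deltaCore hPM) (fun h => hbM (deltaCore_le M h))
  exact congrArg (fun Q : DeltaSpec k R Δ => Q.1.asIdeal) h

/-- The homogenization of a polynomial `p`, evaluated at `(a, b)`, is `b ^ deg p * p (a / b)`. -/
theorem map_homogenize_eq {K : Type u} [Field K] [Algebra k K] [Algebra R K] [IsScalarTower k R K]
    (p : Polynomial k) (a b : R) (hb : algebraMap R K b ≠ 0) :
    algebraMap R K (∑ i ∈ Finset.range (p.natDegree + 1),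
      p.coeff i • (a ^ i * b ^ (p.natDegree - i))) =
    algebraMap R K b ^ p.natDegree * Polynomial.aeval (algebraMap R K a / algebraMap R K b) p := by
  rw [Polynomial.aeval_eq_sum_range, map_sum, Finset.mul_sum]
  refine Finset.sum_congr rfl fun i hi => ?_
  have hi : i ≤ p.natDegree := Nat.lt_succ_iff.1 (Finset.mem_range.1 hi)
  have hpow : algebraMap R K b ^ p.natDegree =
      algebraMap R K b ^ (p.natDegree - i) * algebraMap R K b ^ i := by
    rw [← pow_add, Nat.sub_add_cancel hi]
  rw [Algebra.smul_def, Algebra.smul_def, map_mul, map_mul, map_pow, map_pow,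
    ← IsScalarTower.algebraMap_apply, hpow, div_pow]
  field_simp

/-- If the class of `f / b` in `Frac (R / P)` is algebraic and nonzero, then every prime over `P`
containing `f` contains `b`. -/
theorem mem_of_isAlgebraic_div {P Q : Ideal R} [P.IsPrime] (hQ : Q.IsPrime) (hPQ : P ≤ Q)
    {f b : R} (hf : f ∉ P) (hfQ : f ∈ Q)
    (halg : IsAlgebraic k
      (algebraMap (R ⧸ P) (FractionRing (R ⧸ P)) (Ideal.Quotient.mk P f) /
       algebraMap (R ⧸ P) (FractionRing (R ⧸ P)) (Ideal.Quotient.mk P b))) :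
    b ∈ Q := by
  have hinj : Function.Injective (algebraMap (R ⧸ P) (FractionRing (R ⧸ P))) :=
    IsFractionRing.injective _ _
  have hmk : ∀ x : R, algebraMap (R ⧸ P) (FractionRing (R ⧸ P)) (Ideal.Quotient.mk P x) =
    algebraMap R (FractionRing (R ⧸ P)) x := fun x => rfl
  have hker : ∀ x : R, algebraMap R (FractionRing (R ⧸ P)) x = 0 ↔ x ∈ P := fun x => by
    rw [← hmk, map_eq_zero_iff _ hinj, Ideal.Quotient.eq_zero_iff_mem]
  have hint := halg.inv.isIntegral
  rw [inv_div, hmk, hmk] at hint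
  set p := minpoly k (algebraMap R (FractionRing (R ⧸ P)) b /
    algebraMap R (FractionRing (R ⧸ P)) f) with hp
  have hsum := map_homogenize_eq (K := FractionRing (R ⧸ P)) p b f (mt (hker f).1 hf)
  rw [hp, minpoly.aeval, ← hp, mul_zero, hker, Finset.sum_range_succ, Nat.sub_self, pow_zero,
    mul_one, Polynomial.coeff_natDegree, (minpoly.monic hint).leadingCoeff, one_smul] at hsum
  refine hQ.mem_of_pow_mem p.natDegree ((Q.add_mem_iff_right ?_).1 (hPQ hsum))
  refine Q.sum_mem fun i hi => Submodule.smul_of_tower_mem Q _ (Q.mul_mem_left _ ?_)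
  exact Q.pow_mem_of_mem hfQ _ (Nat.sub_pos_of_lt (Finset.mem_range.1 hi))

/-- If `a / b` is a constant modulo `P`, then so is every form in `a` and `b`, up to the
corresponding power of `b`. -/
theorem mul_derivation_homogenize_sub_mem {P : Ideal R} (δ : Derivation k R R) {a b : R}
    (hab : δ a * b - a * δ b ∈ P) (p : Polynomial k) :
    b * δ (∑ i ∈ Finset.range (p.natDegree + 1), p.coeff i • (a ^ i * b ^ (p.natDegree - i))) -
      p.natDegree * (∑ i ∈ Finset.range (p.natDegree + 1),
        p.coeff i • (a ^ i * b ^ (p.natDegree - i))) * δ b ∈ P := by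
  rw [map_sum, Finset.mul_sum, Finset.mul_sum, Finset.sum_mul, ← Finset.sum_sub_distrib]
  refine P.sum_mem fun i hi => ?_
  obtain ⟨j, hj⟩ := Nat.exists_eq_add_of_le (Nat.lt_succ_iff.1 (Finset.mem_range.1 hi))
  rw [hj, Nat.add_sub_cancel_left, Derivation.map_smul]
  have hmem : b * δ (a ^ i) - i * a ^ i * δ b ∈ P := by
    rcases i with _ | i
    · simp
    · convert P.mul_mem_left ((i + 1 : ℕ) * a ^ i) hab using 1
      rw [Derivation.leibniz_pow]
      simp only [smul_eq_mul, nsmul_eq_mul, Nat.add_sub_cancel]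
      ring
  rw [Algebra.smul_def, Algebra.smul_def]
  convert P.mul_mem_left (algebraMap k R (p.coeff i) * b ^ j) hmem using 1
  simp only [Derivation.leibniz, smul_eq_mul]
  push_cast
  linear_combination (algebraMap k R (p.coeff i) * a ^ i) * δ.mul_apply_pow b j

theorem isDeltaRational_of_isDeltaPrimitive
    (hrank : Module.rank k R < Cardinal.mk k) {P : Ideal R} (hP : P.IsPrime)
    (hΔP : IsDeltaIdeal k R Δ P) (hprim : IsDeltaPrimitive k R Δ P) :
    IsDeltaRational k R Δ P hP := by
  obtain ⟨M, hM, hcore⟩ := hprim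
  have hPM : P ≤ M := hcore ▸ deltaCore_le M
  have hle : ∀ I : Ideal R, IsDeltaIdeal k R Δ I → I ≤ M → I ≤ P := fun I hI hIM =>
    (hI.le_deltaCore hIM).trans_eq hcore
  have hinj : Function.Injective (algebraMap (R ⧸ P) (FractionRing (R ⧸ P))) :=
    IsFractionRing.injective _ _
  have hmk : ∀ x : R, algebraMap (R ⧸ P) (FractionRing (R ⧸ P)) (Ideal.Quotient.mk P x) =
    algebraMap R (FractionRing (R ⧸ P)) x := fun x => rfl
  have hker : ∀ x : R, algebraMap R (FractionRing (R ⧸ P)) x = 0 ↔ x ∈ P := fun x => by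
    rw [← hmk, map_eq_zero_iff _ hinj, Ideal.Quotient.eq_zero_iff_mem]
  have hcase : ∀ a b : R, b ∉ M → (∀ δ ∈ Δ, δ a * b - a * δ b ∈ P) →
      IsAlgebraic k (algebraMap R (FractionRing (R ⧸ P)) a /
        algebraMap R (FractionRing (R ⧸ P)) b) := by
    intro a b hb hab
    let := Ideal.Quotient.field M
    have halgM : Algebra.IsAlgebraic k (R ⧸ M) :=
      isAlgebraic_of_isField_of_rank_lt (Field.toIsField _)
        (((Ideal.Quotient.mkₐ k M).toLinearMap.rank_le_of_surjective
          (Ideal.Quotient.mkₐ_surjective k M)).trans_lt hrank)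
    have hkerM : ∀ x : R, algebraMap R (R ⧸ M) x = 0 ↔ x ∈ M := fun x =>
      Ideal.Quotient.eq_zero_iff_mem
    obtain ⟨p, hp0, hp⟩ := halgM.isAlgebraic (algebraMap R (R ⧸ M) a / algebraMap R (R ⧸ M) b)
    refine ⟨p, hp0, ?_⟩
    have hcM := map_homogenize_eq (K := R ⧸ M) p a b (mt (hkerM b).1 hb)
    have hcP := map_homogenize_eq (K := FractionRing (R ⧸ P)) p a b
      (mt (hker b).1 fun h => hb (hPM h))
    have hδc := fun δ (hδ : δ ∈ Δ) => mul_derivation_homogenize_sub_mem δ (hab δ hδ) p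
    set c : R := ∑ i ∈ Finset.range (p.natDegree + 1), p.coeff i • (a ^ i * b ^ (p.natDegree - i))
      with hc
    rw [hp, mul_zero, hkerM] at hcM
    let J : Ideal R :=
      { carrier := {r | ∃ (N : ℕ) (t : R), b ^ N * r - c * t ∈ P}
        add_mem' := by
          rintro r r' ⟨N, t, h⟩ ⟨N', t', h'⟩
          refine ⟨N + N', b ^ N' * t + b ^ N * t', ?_⟩
          convert P.add_mem (P.mul_mem_left (b ^ N') h) (P.mul_mem_left (b ^ N) h') using 1
          ring
        zero_mem' := ⟨0, 0, by simp⟩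
        smul_mem' := by
          rintro x r ⟨N, t, h⟩
          refine ⟨N, x * t, ?_⟩
          convert P.mul_mem_left x h using 1
          simp only [smul_eq_mul]
          ring }
    have hJΔ : IsDeltaIdeal k R Δ J := by
      rintro δ hδ r ⟨N, t, h⟩
      refine ⟨N + 1, p.natDegree * δ b * t + b * δ t - N * δ b * t, ?_⟩
      have h1 := P.mul_mem_left b (hΔP δ hδ _ h)
      have h2 := P.mul_mem_left t (hδc δ hδ)
      have h3 := P.mul_mem_left (N * δ b) h
      convert P.sub_mem (P.add_mem h1 h2) h3 using 1
      simp only [map_sub, Derivation.leibniz, smul_eq_mul]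
      linear_combination (-r) * δ.mul_apply_pow b N
    have hJM : J ≤ M := by
      rintro r ⟨N, t, h⟩
      have h1 : b ^ N * r ∈ M := by
        simpa using M.add_mem (hPM h) (M.mul_mem_right t hcM)
      exact (hM.isPrime.mem_or_mem h1).resolve_left fun h => hb (hM.isPrime.mem_of_pow_mem _ h)
    have hcmem : c ∈ P := hle J hJΔ hJM ⟨0, 1, by simp⟩
    rw [(hker c).2 hcmem] at hcP
    exact (mul_eq_zero.1 hcP.symm).resolve_left
      (pow_ne_zero _ (mt (hker b).1 fun h => hb (hPM h)))
  intro a b hb hab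
  have hden : ∀ δ ∈ Δ, ∀ r s : R, r * a - s * b ∈ P → δ r * a - δ s * b ∈ P := by
    intro δ hδ r s h
    have h1 := P.mul_mem_left b (hΔP δ hδ _ h)
    have h2 := P.mul_mem_left r (hab δ hδ)
    have h3 := P.mul_mem_left (δ b) h
    refine (hP.mem_or_mem (?_ : b * (δ r * a - δ s * b) ∈ P)).resolve_left hb
    convert P.sub_mem (P.sub_mem h1 h2) h3 using 1
    simp only [map_sub, Derivation.leibniz, smul_eq_mul]
    ring
  let I : Ideal R :=
    { carrier := {r | ∃ s : R, r * a - s * b ∈ P}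
      add_mem' := by
        rintro r r' ⟨s, h⟩ ⟨s', h'⟩
        refine ⟨s + s', ?_⟩
        convert P.add_mem h h' using 1
        ring
      zero_mem' := ⟨0, by simp⟩
      smul_mem' := by
        rintro x r ⟨s, h⟩
        refine ⟨x * s, ?_⟩
        convert P.mul_mem_left x h using 1
        simp only [smul_eq_mul]
        ring }
  have hIΔ : IsDeltaIdeal k R Δ I := by
    rintro δ hδ r ⟨s, h⟩
    exact ⟨δ s, hden δ hδ r s h⟩
  have hIM : ¬ I ≤ M := fun h => hb (hle I hIΔ h ⟨a, by rw [mul_comm, sub_self]; exact P.zero_mem⟩)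
  obtain ⟨r, ⟨s, hrs⟩, hrM⟩ := SetLike.not_le_iff_exists.1 hIM
  have hrP : r ∉ P := fun h => hrM (hPM h)
  have heq : algebraMap R (FractionRing (R ⧸ P)) a / algebraMap R (FractionRing (R ⧸ P)) b =
      algebraMap R (FractionRing (R ⧸ P)) s / algebraMap R (FractionRing (R ⧸ P)) r := by
    rw [div_eq_div_iff (mt (hker b).1 hb) (mt (hker r).1 hrP), ← map_mul, ← map_mul,
      ← sub_eq_zero, ← map_sub, hker, mul_comm a r]
    exact hrs
  rw [hmk, hmk, heq]
  refine hcase s r hrM fun δ hδ => ?_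
  refine (hP.mem_or_mem (?_ : b * (δ s * r - s * δ r) ∈ P)).resolve_left hb
  convert P.sub_mem (P.mul_mem_left (δ r) hrs) (P.mul_mem_left r (hden δ hδ r s hrs)) using 1
  ring

theorem mk_iUnion_le_of_le {ι α : Type u} {f : ι → Set α} {μ : Cardinal.{u}}
    (hμ : Cardinal.aleph0 ≤ μ) (hι : Cardinal.mk ι ≤ μ) (hf : ∀ i, Cardinal.mk (f i) ≤ μ) :
    Cardinal.mk (⋃ i, f i : Set α) ≤ μ :=
  (Cardinal.mk_iUnion_le f).trans <|
    (mul_le_mul' hι (ciSup_le' hf)).trans (Cardinal.mul_eq_self hμ).le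

/-- If `P` is `Δ`-rational, then for every finitely generated subspace `V` of `R` there is a small
set of elements outside `P` meeting all `Δ`-primes `Q` over `P` with `V ∩ Q ⊈ P`. -/
theorem exists_test_set_of_span {P : Ideal R} (hP : P.IsPrime) (hrat : IsDeltaRational k R Δ P hP)
    {μ : Cardinal.{u}} (hμ : Cardinal.aleph0 ≤ μ) (hΔ : Cardinal.mk Δ ≤ μ) (l : List R) :
    ∃ G : Set R, Cardinal.mk G ≤ μ ∧ (∀ g ∈ G, g ∉ P) ∧
      ∀ Q : Ideal R, IsDeltaPrime k R Δ Q → P ≤ Q →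
        ∀ f ∈ Submodule.span k {x | x ∈ l}, f ∈ Q → f ∉ P → ∃ g ∈ G, g ∈ Q := by
  induction hn : l.length generalizing l with
  | zero =>
    obtain rfl := List.length_eq_zero_iff.1 hn
    refine ⟨∅, by simp, by simp, fun Q _ _ f hf _ hfP => ?_⟩
    have hf0 : f = 0 := by simpa using hf
    exact absurd (hf0 ▸ P.zero_mem) hfP
  | succ n ih =>
    obtain ⟨b, l, rfl⟩ := List.exists_cons_of_length_eq_add_one hn
    have hl : l.length = n := by simpa using hn
    have hset : {x | x ∈ b :: l} = insert b {x | x ∈ l} := by ext; simp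
    simp only [hset, Submodule.mem_span_insert]
    by_cases hb : b ∈ P
    · obtain ⟨G, hG, hGP, hGQ⟩ := ih l hl
      refine ⟨G, hG, hGP, ?_⟩
      rintro Q hQ hPQ _ ⟨c, f, hf, rfl⟩ hfQ hfP
      have hcb : c • b ∈ P := Submodule.smul_of_tower_mem P c hb
      exact hGQ Q hQ hPQ f hf ((Q.add_mem_iff_right (hPQ hcb)).1 hfQ)
        (fun h => hfP (P.add_mem hcb h))
    · let T : Derivation k R R → R →ₗ[k] R := fun δ =>
        LinearMap.mulLeft k b ∘ₗ (δ : R →ₗ[k] R) - LinearMap.mulRight k (δ b)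
      have hT : ∀ δ x, T δ x = b * δ x - x * δ b := fun δ x => rfl
      choose G hG hGP hGQ using fun δ : Δ => ih (l.map (T δ)) (by simpa using hl)
      refine ⟨{b} ∪ ⋃ δ : Δ, G δ, ?_, ?_, ?_⟩
      · refine (Cardinal.mk_union_le _ _).trans (Cardinal.add_le_of_le hμ ?_ ?_)
        · rw [Cardinal.mk_singleton]
          exact Cardinal.one_le_aleph0.trans hμ
        · exact mk_iUnion_le_of_le hμ hΔ hG
      · rintro g (rfl | hg)
        · exact hb
        · obtain ⟨δ, hδ⟩ := Set.mem_iUnion.1 hg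
          exact hGP δ g hδ
      · rintro Q hQ hPQ F ⟨c, f, hf, rfl⟩ hfQ hfP
        by_cases hconst : ∀ δ ∈ Δ, δ (c • b + f) * b - (c • b + f) * δ b ∈ P
        · exact ⟨b, Or.inl rfl, mem_of_isAlgebraic_div hQ.1 hPQ hfP hfQ (hrat _ b hb hconst)⟩
        · push Not at hconst
          obtain ⟨δ, hδ, hδf⟩ := hconst
          have heq : δ (c • b + f) * b - (c • b + f) * δ b = T δ f := by
            rw [hT, map_add, Derivation.map_smul, Algebra.smul_def, Algebra.smul_def]
            ring
          have hmem : T δ f ∈ Submodule.span k {x | x ∈ l.map (T δ)} := by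
            have := Submodule.mem_map_of_mem (f := T δ) hf
            rw [Submodule.map_span] at this
            convert this using 2
            ext; simp
          obtain ⟨g, hg, hgQ⟩ := hGQ ⟨δ, hδ⟩ Q hQ hPQ _ hmem
            (heq ▸ Q.sub_mem (Q.mul_mem_right _ (hQ.2 δ hδ _ hfQ)) (Q.mul_mem_right _ hfQ))
            (heq ▸ hδf)
          exact ⟨g, Or.inr (Set.mem_iUnion.2 ⟨⟨δ, hδ⟩, hg⟩), hgQ⟩

/-- `Δ`-rational `Δ`-primes are `κ`-separable, as soon as `κ` is uncountable and larger than
`dim_k R` and `|Δ|`. -/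
theorem deltaSeparable_of_isDeltaRational [CharZero k] [IsNoetherianRing R]
    {κ : Cardinal.{u}} (hκ : Cardinal.aleph0 < κ)
    (hrank : Module.rank k R < κ) (hΔ : Cardinal.mk Δ < κ) {P : Ideal R} (hP : P.IsPrime)
    (hrat : IsDeltaRational k R Δ P hP) :
    DeltaSeparable k R Δ κ P := by
  let B := Module.Basis.ofVectorSpace k R
  set S : Set R := Set.range B with hS
  set μ : Cardinal.{u} := max Cardinal.aleph0 (max (Module.rank k R) (Cardinal.mk Δ)) with hμdef
  have hμκ : μ < κ := max_lt hκ (max_lt hrank hΔ)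
  have hμ : Cardinal.aleph0 ≤ μ := le_max_left _ _
  have hΔμ : Cardinal.mk Δ ≤ μ := (le_max_right _ _).trans (le_max_right _ _)
  have hSμ : Cardinal.mk S ≤ μ :=
    ((Cardinal.mk_range_le.trans B.mk_eq_rank''.le).trans (le_max_left _ _)).trans
      (le_max_right _ _)
  choose G hG hGP hGQ using fun l : List S =>
    exists_test_set_of_span hP hrat hμ hΔμ (l.map Subtype.val)
  let J : R → Ideal R := fun g => sInf {I | IsDeltaIdeal k R Δ I ∧ P ≤ I ∧ g ∈ I}
  have hJ : ∀ g, IsDeltaIdeal k R Δ (J g) := fun g => IsDeltaIdeal.sInf fun I hI => hI.1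
  have hPJ : ∀ g, P ≤ J g := fun g => le_sInf fun I hI => hI.2.1
  have hgJ : ∀ g, g ∈ J g := fun g => Submodule.mem_sInf.2 fun I hI => hI.2.2
  refine ⟨⋃ l : List S, ⋃ g : G l, (J g).minimalPrimes, ?_, ?_, ?_⟩
  · intro Q hQ
    obtain ⟨l, hQ⟩ := Set.mem_iUnion.1 hQ
    obtain ⟨g, hQ⟩ := Set.mem_iUnion.1 hQ
    refine ⟨⟨hQ.1.1, (hJ g).of_mem_minimalPrimes hQ⟩, (hPJ g).trans hQ.1.2, fun h => ?_⟩
    exact hGP l g g.2 (h (hQ.1.2 (hgJ g)))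
  · refine lt_of_le_of_lt ?_ hμκ
    refine mk_iUnion_le_of_le hμ ((Cardinal.mk_list_le_max S).trans (max_le hμ hSμ)) fun l => ?_
    refine mk_iUnion_le_of_le hμ (hG l) fun g => ?_
    exact (Ideal.finite_minimalPrimes_of_isNoetherianRing R (J g)).lt_aleph0.le.trans hμ
  · intro Q hQ hPQ
    obtain ⟨f, hfQ, hfP⟩ := SetLike.exists_of_lt hPQ
    have hf : f ∈ Submodule.span k S := by
      rw [hS, B.span_eq]
      exact Submodule.mem_top
    obtain ⟨T, hTS, hfT⟩ := Submodule.mem_span_finite_of_mem_span hf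
    obtain ⟨l, hl⟩ : ∃ l : List S, l.map Subtype.val = T.toList :=
      CanLift.prf T.toList fun x hx => hTS (Finset.mem_toList.1 hx)
    obtain ⟨g, hg, hgQ⟩ := hGQ l Q hQ hPQ.le f (by simpa [hl] using hfT) hfQ hfP
    have hQp : Q.IsPrime := hQ.1
    obtain ⟨Q', hQ', hle⟩ := Ideal.exists_minimalPrimes_le (I := J g) (J := Q)
      (sInf_le ⟨hQ.2, hPQ.le, hgQ⟩)
    exact ⟨Q', Set.mem_iUnion.2 ⟨l, Set.mem_iUnion.2 ⟨⟨g, hg⟩, hQ'⟩⟩, hle⟩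

end DixmierMoeglin

/-- A noetherian domain of dimension less than `|k|` whose generic point is `|k|`-separable in its
prime spectrum is a field. -/
theorem isField_of_separable {k A : Type u} [Field k] [CommRing A] [IsDomain A] [Algebra k A]
    [IsNoetherianRing A] (hrank : Module.rank k A < Cardinal.mk k)
    (hsep : Cardinal.aleph0 < Cardinal.mk k → ∃ Λ : Set (Ideal A),
      (∀ q ∈ Λ, q.IsPrime ∧ q ≠ ⊥) ∧ Cardinal.mk Λ < Cardinal.mk k ∧
      ∀ q : Ideal A, q.IsPrime → q ≠ ⊥ → ∃ q' ∈ Λ, q' ≤ q) :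
    IsField A := by
  by_contra hfield
  obtain ⟨t, ht⟩ : ∃ t : A, Transcendental k t := by
    by_contra! h
    refine hfield ⟨exists_pair_ne A, mul_comm, fun {a} ha => ?_⟩
    obtain ⟨u, rfl⟩ := (not_not.1 (h a)).isIntegral.isUnit ha
    exact ⟨_, u.mul_inv⟩
  have hk : Cardinal.aleph0 < Cardinal.mk k := by
    have hli := (Polynomial.basisMonomials k).linearIndependent.map'
      (Polynomial.aeval t).toLinearMap (LinearMap.ker_eq_bot.2 (transcendental_iff_injective.1 ht))
    exact hli.aleph0_le_rank.trans_lt hrank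
  have : Infinite k := Cardinal.infinite_iff.2 hk.le
  obtain ⟨Λ, hΛ, hΛk, hsep⟩ := hsep hk
  have hcompl : Cardinal.mk {a : k | ¬ IsUnit (t - algebraMap k A a)} = Cardinal.mk k :=
    Cardinal.mk_compl_of_infinite {a : k | IsUnit (t - algebraMap k A a)}
      (ht.mk_isUnit_sub_le_rank.trans_lt hrank)
  have hprime : ∀ a : {a : k | ¬ IsUnit (t - algebraMap k A a)},
      ∃ q ∈ Λ, t - algebraMap k A a ∈ q := by
    rintro ⟨a, ha⟩
    obtain ⟨M, hM, hmem⟩ := exists_max_ideal_of_mem_nonunits ha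
    have hMp := hM.isPrime
    obtain ⟨q, hq, -⟩ := Ideal.exists_minimalPrimes_le
      (I := Ideal.span {t - algebraMap k A a}) (J := M)
      ((Ideal.span_singleton_le_iff_mem M).2 hmem)
    have hqp : q.IsPrime := hq.1.1
    have hmemq : t - algebraMap k A a ∈ q := hq.1.2 (Ideal.mem_span_singleton_self _)
    have hq0 : q ≠ ⊥ := by
      rintro rfl
      refine ht ?_
      rw [sub_eq_zero.1 (Ideal.mem_bot.1 hmemq)]
      exact isAlgebraic_algebraMap a
    obtain ⟨q', hq'Λ, hle⟩ := hsep q hqp hq0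
    obtain ⟨hq'p, hq'0⟩ := hΛ q' hq'Λ
    have hht := Ideal.height_le_one_of_isPrincipal_of_mem_minimalPrimes _ q hq
    have heq : q' = q := by
      by_contra hne
      have h1 := Ideal.height_add_one_le_of_lt_of_isPrime (lt_of_le_of_ne hle hne)
      have h2 := Ideal.height_add_one_le_of_lt_of_isPrime (bot_lt_iff_ne_bot.2 hq'0)
      have h3 : (1 : ℕ∞) + 1 ≤ 1 :=
        ((add_le_add_left (le_add_self.trans h2) 1).trans h1).trans hht
      exact absurd h3 (by decide)
    exact ⟨q', hq'Λ, heq ▸ hmemq⟩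
  choose q hqΛ hq using hprime
  have hinj : Function.Injective (fun a => (⟨q a, hqΛ a⟩ : Λ)) := by
    intro a a' haa'
    by_contra hne
    have h0 : (a' : k) - a ≠ 0 := sub_ne_zero.2 fun h => hne (Subtype.ext h.symm)
    have hqq : q a = q a' := congrArg Subtype.val haa'
    have hmem : algebraMap k A (a' - a) ∈ q a := by
      have h := (q a).sub_mem (hq a) (hqq ▸ hq a' : t - algebraMap k A a' ∈ q a)
      rwa [sub_sub_sub_cancel_left, ← map_sub] at h
    exact (hΛ _ (hqΛ a)).1.ne_top
      (Ideal.eq_top_of_isUnit_mem _ hmem ((IsUnit.mk0 _ h0).map (algebraMap k A)))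
  exact absurd (hcompl.symm.trans_le (Cardinal.mk_le_of_injective hinj)) (not_le.2 hΛk)

section Stratification

variable {k R A : Type u} [Field k] [CommRing R] [Algebra k R] {Δ : Set (Derivation k R R)}
  [CommRing A] {X : Set (DeltaSpec k R Δ)}

theorem asIdeal_homeomorph_le_iff (h : X ≃ₜ PrimeSpectrum A) (y z : X) :
    (h y).asIdeal ≤ (h z).asIdeal ↔ y.1.1.asIdeal ≤ z.1.1.asIdeal := by
  rw [PrimeSpectrum.asIdeal_le_asIdeal, PrimeSpectrum.asIdeal_le_asIdeal,
    PrimeSpectrum.le_iff_specializes, PrimeSpectrum.le_iff_specializes,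
    h.isInducing.specializes_iff, subtype_specializes_iff, subtype_specializes_iff]

/-- Locally closed sets are convex for the inclusion order. -/
theorem IsLocallyClosed.mem_of_le_of_le (hX : IsLocallyClosed X) {P Q Q' : DeltaSpec k R Δ}
    (hP : P ∈ X) (hQ : Q ∈ X) (hPQ' : P.1.asIdeal ≤ Q'.1.asIdeal)
    (hQ'Q : Q'.1.asIdeal ≤ Q.1.asIdeal) : Q' ∈ X := by
  obtain ⟨U, Z, hU, hZ, rfl⟩ := hX
  have h1 : P ⤳ Q' := by
    rw [subtype_specializes_iff, ← PrimeSpectrum.le_iff_specializes]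
    exact hPQ'
  have h2 : Q' ⤳ Q := by
    rw [subtype_specializes_iff, ← PrimeSpectrum.le_iff_specializes]
    exact hQ'Q
  exact ⟨h2.mem_open hU hQ.1, h1.mem_closed hZ hP.2⟩

/-- Separability of a `Δ`-prime passes to the generic point of the corresponding closed subset of
a stratum. -/
theorem DeltaSeparable.exists_separating_set {κ : Cardinal.{u}} (hX : IsLocallyClosed X)
    (h : X ≃ₜ PrimeSpectrum A) (x : X) (hsep : DeltaSeparable k R Δ κ x.1.1.asIdeal) :
    ∃ Λ : Set (Ideal (A ⧸ (h x).asIdeal)), (∀ q ∈ Λ, q.IsPrime ∧ q ≠ ⊥) ∧ Cardinal.mk Λ < κ ∧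
      ∀ q : Ideal (A ⧸ (h x).asIdeal), q.IsPrime → q ≠ ⊥ → ∃ q' ∈ Λ, q' ≤ q := by
  obtain ⟨Λ, hΛ, hΛκ, hsep⟩ := hsep
  set π := Ideal.Quotient.mk (h x).asIdeal with hπ
  have hπs : Function.Surjective π := Ideal.Quotient.mk_surjective
  have hbot : (⊥ : Ideal (A ⧸ (h x).asIdeal)).comap π = (h x).asIdeal := by
    rw [← RingHom.ker_eq_comap_bot, hπ, Ideal.mk_ker]
  have hcomap : Function.Injective (Ideal.comap π) := Ideal.comap_injective_of_surjective π hπs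
  have hex : ∀ q : {q : Ideal (A ⧸ (h x).asIdeal) | q.IsPrime ∧
      ∃ y : X, y.1.1.asIdeal ∈ Λ ∧ (h y).asIdeal = q.comap π},
      ∃ y : X, y.1.1.asIdeal ∈ Λ ∧ (h y).asIdeal = q.1.comap π := fun q => q.2.2
  choose y hyΛ hyq using hex
  refine ⟨{q | q.IsPrime ∧ ∃ y : X, y.1.1.asIdeal ∈ Λ ∧ (h y).asIdeal = q.comap π}, ?_, ?_, ?_⟩
  · rintro q ⟨hq, y, hyΛ, hyq⟩
    refine ⟨hq, ?_⟩
    rintro rfl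
    rw [hbot] at hyq
    rw [h.injective (PrimeSpectrum.ext hyq)] at hyΛ
    exact lt_irrefl _ (hΛ _ hyΛ).2
  · refine lt_of_le_of_lt ?_ hΛκ
    refine Cardinal.mk_le_of_injective (f := fun q => (⟨_, hyΛ q⟩ : Λ)) fun q q' hqq' => ?_
    have hyy : y q = y q' :=
      Subtype.ext (Subtype.ext (PrimeSpectrum.ext (congrArg Subtype.val hqq')))
    exact Subtype.ext (hcomap (by rw [← hyq, ← hyq, hyy]))
  · intro q hq hq0
    obtain ⟨z, hz⟩ := h.surjective ⟨q.comap π, hq.comap π⟩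
    have hzq : (h z).asIdeal = q.comap π := by rw [hz]
    have hle : (h x).asIdeal ≤ (h z).asIdeal := by
      rw [hzq]
      exact hbot.ge.trans (Ideal.comap_mono bot_le)
    have hlt : x.1.1.asIdeal < z.1.1.asIdeal := by
      refine lt_of_le_of_ne ((asIdeal_homeomorph_le_iff h x z).1 hle) fun heq => hq0 ?_
      have hxz : x = z := Subtype.ext (Subtype.ext (PrimeSpectrum.ext heq))
      exact hcomap (by rw [hbot, ← hzq, hxz])
    obtain ⟨Q, hQΛ, hQz⟩ := hsep z.1.1.asIdeal ⟨z.1.1.isPrime, z.1.2⟩ hlt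
    obtain ⟨⟨hQp, hQΔ⟩, hxQ⟩ := hΛ Q hQΛ
    let y' : X := ⟨⟨⟨Q, hQp⟩, hQΔ⟩, hX.mem_of_le_of_le x.2 z.2 hxQ.le hQz⟩
    have hxy : (h x).asIdeal ≤ (h y').asIdeal := (asIdeal_homeomorph_le_iff h x y').2 hxQ.le
    have hyz : (h y').asIdeal ≤ (h z).asIdeal := (asIdeal_homeomorph_le_iff h y' z).2 hQz
    have hker : RingHom.ker π ≤ (h y').asIdeal := by rwa [hπ, Ideal.mk_ker]
    refine ⟨(h y').asIdeal.map π, ⟨Ideal.map_isPrime_of_surjective hπs hker, y', hQΛ, ?_⟩,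
      Ideal.map_le_iff_le_comap.2 (hyz.trans_eq hzq)⟩
    rw [Ideal.comap_map_of_surjective π hπs, ← RingHom.ker_eq_comap_bot, sup_eq_left.2 hker]

theorem isLocallyClosed_singleton_of_isMaximal (hX : IsLocallyClosed X)
    (h : X ≃ₜ PrimeSpectrum A) (x : X) (hmax : (h x).asIdeal.IsMaximal) :
    IsLocallyClosed ({x.1} : Set (DeltaSpec k R Δ)) := by
  have hclosed : IsClosed ({x} : Set X) := by
    have := (PrimeSpectrum.isClosed_singleton_iff_isMaximal (h x)).2 hmax
    rwa [← Set.image_singleton, h.isClosed_image] at this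
  obtain ⟨Z, hZ, hxZ⟩ := isClosed_induced_iff.1 hclosed
  have heq : ({x.1} : Set (DeltaSpec k R Δ)) = X ∩ Z := by
    rw [← Subtype.image_preimage_coe, hxZ, Set.image_singleton]
  rw [heq]
  exact hX.inter hZ.isLocallyClosed

end Stratification

/-- If `Δ`-spec `R` is covered by locally closed subsets each homeomorphic to the prime spectrum
of a commutative noetherian `k`-algebra of `k`-dimension `< |k|`, then `R` satisfies the
`Δ`-Dixmier–Moeglin equivalence. -/
theorem deltaDME_of_spec_stratification (k R : Type u) [Field k] [CharZero k]
    [CommRing R] [Algebra k R] [IsNoetherianRing R]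
    (hrank : Module.rank k R < Cardinal.mk k)
    (Δ : Set (Derivation k R R)) (hΔ : Cardinal.mk Δ < Cardinal.mk k)
    (ι : Type u) (Ri : ι → Type u) [∀ i, CommRing (Ri i)] [∀ i, Algebra k (Ri i)]
    [∀ i, IsNoetherianRing (Ri i)]
    (hranki : ∀ i, Module.rank k (Ri i) < Cardinal.mk k)
    (X : ι → Set (DeltaSpec k R Δ))
    (hcover : (⋃ i, X i) = Set.univ)
    (hlc : ∀ i, IsLocallyClosed (X i))
    (hhomeo : ∀ i, Nonempty (X i ≃ₜ PrimeSpectrum (Ri i))) :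
    DeltaDME k R Δ := by
  intro P hP
  have h1 : IsLocallyClosed ({⟨P, hP⟩} : Set (DeltaSpec k R Δ)) →
      IsDeltaPrimitive k R Δ P.asIdeal := fun h =>
    isDeltaPrimitive_of_isLocallyClosed hrank h
  have h2 : IsDeltaPrimitive k R Δ P.asIdeal → IsDeltaRational k R Δ P.asIdeal P.isPrime :=
    isDeltaRational_of_isDeltaPrimitive hrank P.isPrime hP
  have h3 : IsDeltaRational k R Δ P.asIdeal P.isPrime →
      IsLocallyClosed ({⟨P, hP⟩} : Set (DeltaSpec k R Δ)) := by
    intro hrat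
    obtain ⟨i, hi⟩ := Set.mem_iUnion.1 (hcover ▸ Set.mem_univ (⟨P, hP⟩ : DeltaSpec k R Δ))
    obtain ⟨h⟩ := hhomeo i
    refine isLocallyClosed_singleton_of_isMaximal (hlc i) h ⟨_, hi⟩ ?_
    refine Ideal.Quotient.maximal_of_isField _ (isField_of_separable (k := k) ?_ fun hk => ?_)
    · exact ((Ideal.Quotient.mkₐ k _).toLinearMap.rank_le_of_surjective
        (Ideal.Quotient.mkₐ_surjective k _)).trans_lt (hranki i)
    · exact DeltaSeparable.exists_separating_set (hlc i) h ⟨_, hi⟩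
        (deltaSeparable_of_isDeltaRational hk hrank hΔ P.isPrime hrat)
  exact ⟨⟨h1, fun h => h3 (h2 h)⟩, ⟨h2, fun h => h1 (h3 h)⟩⟩
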